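/- If G is a connected n-vertex graph with no induced 6-cycles and maximum degree Δ(G) ≥ 5, then ι(G, P_3) ≤ ⌊n/4⌋. -/

import Mathlib

open SimpleGraph

/-- The closed neighbourhood `N[D]` of a set `D` of vertices in a graph `G`. -/
def closedNbhd {V : Type*} (G : SimpleGraph V) (D : Set V) : Set V :=
  D ∪ {v | ∃ d ∈ D, G.Adj d v}

/-- `G` contains a (not necessarily induced) copy of `H`. -/
def ContainsCopy {α β : Type*} (G : SimpleGraph α) (H : SimpleGraph β) : Prop :=
  ∃ f : β ↪ α, ∀ a b, H.Adj a b → G.Adj (f a) (f b)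

/-- `D` is a `P₃`-isolating set of `G`: `G − N[D]` contains no 3-vertex path. -/
def IsP3IsolatingSet {V : Type*} (G : SimpleGraph V) (D : Set V) : Prop :=
  ¬ ContainsCopy (SimpleGraph.induce (closedNbhd G D)ᶜ G) (SimpleGraph.pathGraph 3)

/-- The `P₃`-isolation number of `G`. -/
noncomputable def iotaP3 {V : Type*} (G : SimpleGraph V) : ℕ :=
  sInf {m | ∃ D : Set V, IsP3IsolatingSet G D ∧ D.ncard = m}

/-- `G` has an induced 6-cycle. -/
def HasInducedC6 {V : Type*} (G : SimpleGraph V) : Prop :=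
  ∃ f : Fin 6 ↪ V, ∀ a b, G.Adj (f a) (f b) ↔ (SimpleGraph.cycleGraph 6).Adj a b

namespace P3Iso

open Classical

set_option linter.unusedVariables false

variable {V : Type*} (G : SimpleGraph V)

/-- `d` dominates `z`. -/
def Dom (d z : V) : Prop := z = d ∨ G.Adj d z

/-- `D` isolates all 3-paths inside `S`. -/
def Iso (D S : Finset V) : Prop :=
  ∀ a b c, a ∈ S → b ∈ S → c ∈ S → a ≠ c → G.Adj a b → G.Adj b c →
    ∃ d ∈ D, Dom G d a ∨ Dom G d b ∨ Dom G d c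

/-- minimum size of a set isolating all 3-paths inside `S`. -/
noncomputable def f (S : Finset V) : ℕ := sInf {m | ∃ D, Iso G D S ∧ D.card = m}

lemma f_spec (S : Finset V) : ∃ D, Iso G D S ∧ D.card = f G S := by
  have : f G S ∈ {m | ∃ D, Iso G D S ∧ D.card = m} := by
    apply Nat.sInf_mem
    exact ⟨S.card, S, fun a b c ha _ _ _ _ _ => ⟨a, ha, Or.inl (Or.inl rfl)⟩, rfl⟩
  exact this

lemma f_le {D S : Finset V} (h : Iso G D S) : f G S ≤ D.card :=
  Nat.sInf_le ⟨D, h, rfl⟩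

lemma f_mono {S T : Finset V} (h : S ⊆ T) : f G S ≤ f G T := by
  obtain ⟨D, hD, hc⟩ := f_spec G T
  rw [← hc]
  exact f_le G fun a b c ha hb hc => hD a b c (h ha) (h hb) (h hc)

lemma f_small {S : Finset V} (h : S.card ≤ 2) : f G S = 0 := by
  have : Iso G ∅ S := by
    intro a b c ha hb hc hac hab hbc
    exfalso
    have h1 : ({a, b, c} : Finset V) ⊆ S := by
      intro z hz
      simp at hz
      rcases hz with rfl | rfl | rfl <;> assumption
    have h2 := Finset.card_le_card h1
    rw [Finset.card_eq_three.mpr ⟨a, b, c, hab.ne, hac, hbc.ne, rfl⟩] at h2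
    omega
  have := f_le G this
  simpa using this

lemma f_union {A B : Finset V} (h : ∀ a ∈ A, ∀ b ∈ B, ¬ G.Adj a b) (hd : Disjoint A B) :
    f G (A ∪ B) ≤ f G A + f G B := by
  obtain ⟨D, hD, hc⟩ := f_spec G A
  obtain ⟨D', hD', hc'⟩ := f_spec G B
  have : Iso G (D ∪ D') (A ∪ B) := by
    intro x y z hx hy hz hxz hxy hyz
    rw [Finset.disjoint_left] at hd
    have h' : ∀ a ∈ A, ∀ b ∈ B, ¬ G.Adj b a := fun a ha b hb hab => h a ha b hb hab.symm
    rcases Finset.mem_union.1 hy with hy | hy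
    · have hx : x ∈ A := by
        rcases Finset.mem_union.1 hx with hx | hx
        · exact hx
        · exact absurd hxy (h' _ hy _ hx)
      have hz : z ∈ A := by
        rcases Finset.mem_union.1 hz with hz | hz
        · exact hz
        · exact absurd hyz (h _ hy _ hz)
      obtain ⟨d, hd, hh⟩ := hD x y z hx hy hz hxz hxy hyz
      exact ⟨d, Finset.mem_union_left _ hd, hh⟩
    · have hx : x ∈ B := by
        rcases Finset.mem_union.1 hx with hx | hx
        · exact absurd hxy (h _ hx _ hy)
        · exact hx
      have hz : z ∈ B := by
        rcases Finset.mem_union.1 hz with hz | hz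
        · exact absurd hyz (h' _ hz _ hy)
        · exact hz
      obtain ⟨d, hd, hh⟩ := hD' x y z hx hy hz hxz hxy hyz
      exact ⟨d, Finset.mem_union_right _ hd, hh⟩
  have h1 := f_le G this
  have h2 := Finset.card_union_le D D'
  omega

lemma f_dom {D S S' : Finset V} (h : ∀ z ∈ S, z ∉ S' → ∃ d ∈ D, Dom G d z) :
    f G S ≤ D.card + f G S' := by
  obtain ⟨D', hD', hc'⟩ := f_spec G S'
  have : Iso G (D ∪ D') S := by
    intro x y z hx hy hz hxz hxy hyz
    by_cases hx' : x ∈ S'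
    · by_cases hy' : y ∈ S'
      · by_cases hz' : z ∈ S'
        · obtain ⟨d, hd, hh⟩ := hD' x y z hx' hy' hz' hxz hxy hyz
          exact ⟨d, Finset.mem_union_right _ hd, hh⟩
        · obtain ⟨d, hd, hh⟩ := h z hz hz'
          exact ⟨d, Finset.mem_union_left _ hd, by tauto⟩
      · obtain ⟨d, hd, hh⟩ := h y hy hy'
        exact ⟨d, Finset.mem_union_left _ hd, by tauto⟩
    · obtain ⟨d, hd, hh⟩ := h x hx hx'
      exact ⟨d, Finset.mem_union_left _ hd, by tauto⟩
  have h1 := f_le G this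
  have h2 := Finset.card_union_le D D'
  omega

/-- `S` is nonempty and induces a connected graph. -/
def Conn (S : Finset V) : Prop :=
  S.Nonempty ∧ ∀ T ⊆ S, T.Nonempty → T ≠ S → ∃ a ∈ T, ∃ b ∈ S, b ∉ T ∧ G.Adj a b

/-- `P` is the set of components of `S`. -/
structure Parts (P : Finset (Finset V)) (S : Finset V) : Prop where
  conn : ∀ C ∈ P, Conn G C
  sub : ∀ C ∈ P, C ⊆ S
  closed : ∀ C ∈ P, ∀ a ∈ C, ∀ b ∈ S, G.Adj a b → b ∈ C
  disj : ∀ C ∈ P, ∀ C' ∈ P, C ≠ C' → Disjoint C C'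
  union : P.biUnion id = S

lemma exists_parts (S : Finset V) : ∃ P, Parts G P S := by
  induction S using Finset.strongInduction with
  | H S ih =>
    by_cases hS : S.Nonempty
    · by_cases hc : Conn G S
      · refine ⟨{S}, ?_, ?_, ?_, ?_, ?_⟩
        · simpa using hc
        · simp
        · intro C hC a ha b hb hab
          rw [Finset.mem_singleton.1 hC]; exact hb
        · simp
        · simp
      · unfold Conn at hc
        push Not at hc
        obtain ⟨T, hTS, hT, hne, hT2⟩ := hc hS
        have hss : T ⊂ S := hTS.ssubset_of_ne hne
        obtain ⟨P, hP⟩ := ih T hss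
        obtain ⟨Q, hQ⟩ := ih (S \ T) (Finset.sdiff_ssubset hTS hT)
        refine ⟨P ∪ Q, ?_, ?_, ?_, ?_, ?_⟩
        · intro C hC
          rcases Finset.mem_union.1 hC with h | h
          · exact hP.conn C h
          · exact hQ.conn C h
        · intro C hC
          rcases Finset.mem_union.1 hC with h | h
          · exact (hP.sub C h).trans hTS
          · exact (hQ.sub C h).trans Finset.sdiff_subset
        · intro C hC a ha b hb hab
          rcases Finset.mem_union.1 hC with h | h
          · apply hP.closed C h a ha b _ hab
            by_contra hbT
            exact hT2 a (hP.sub C h ha) b hb hbT hab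
          · apply hQ.closed C h a ha b _ hab
            have := Finset.mem_sdiff.1 (hQ.sub C h ha)
            refine Finset.mem_sdiff.2 ⟨hb, fun hbT => hT2 b hbT a this.1 this.2 hab.symm⟩
        · have key : ∀ C ∈ P, ∀ C' ∈ Q, Disjoint C C' := by
            intro C hC C' hC'
            exact Finset.disjoint_of_subset_left (hP.sub C hC)
              (Finset.disjoint_of_subset_right (hQ.sub C' hC') Finset.disjoint_sdiff)
          intro C hC C' hC' hne
          rcases Finset.mem_union.1 hC with h | h <;> rcases Finset.mem_union.1 hC' with h' | h'
          · exact hP.disj C h C' h' hne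
          · exact key C h C' h'
          · exact (key C' h' C h).symm
          · exact hQ.disj C h C' h' hne
        · rw [Finset.union_biUnion, hP.union, hQ.union]
          exact Finset.union_sdiff_of_subset hTS
    · rw [Finset.not_nonempty_iff_eq_empty] at hS
      subst hS
      exact ⟨∅, by constructor <;> simp⟩

lemma Parts.card {P : Finset (Finset V)} {S : Finset V} (h : Parts G P S) :
    S.card = ∑ C ∈ P, C.card := by
  conv_lhs => rw [← h.union]
  exact Finset.card_biUnion fun C hC C' hC' hne => h.disj C hC C' hC' hne

lemma f_biUnion {P : Finset (Finset V)} {S : Finset V} (h : Parts G P S)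
    (g : Finset V → Finset V) (hg : ∀ C ∈ P, g C ⊆ C) :
    ∀ Q ⊆ P, f G (Q.biUnion g) ≤ ∑ C ∈ Q, f G (g C) := by
  intro Q
  induction Q using Finset.induction_on with
  | empty => intro _; simp [f_small G (S := (∅ : Finset V)) (by simp)]
  | insert C Q hC ih =>
    intro hQ
    rw [Finset.sum_insert hC, Finset.biUnion_insert]
    have hCP : C ∈ P := hQ (Finset.mem_insert_self _ _)
    have h2 := ih fun x hx => hQ (Finset.mem_insert_of_mem hx)
    refine (f_union G ?_ ?_).trans (Nat.add_le_add_left h2 _)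
    · intro a ha b hb hab
      obtain ⟨C', hC', hb⟩ := Finset.mem_biUnion.1 hb
      have hC'P : C' ∈ P := hQ (Finset.mem_insert_of_mem hC')
      have hb' := hg C' hC'P hb
      have := h.closed C hCP a (hg C hCP ha) b (h.sub C' hC'P hb') hab
      have hne : C ≠ C' := by rintro rfl; exact hC hC'
      exact Finset.disjoint_left.1 (h.disj C hCP C' hC'P hne) this hb'
    · rw [Finset.disjoint_biUnion_right]
      intro C' hC'
      have hC'P : C' ∈ P := hQ (Finset.mem_insert_of_mem hC')
      have hne : C ≠ C' := by rintro rfl; exact hC hC'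
      exact Finset.disjoint_of_subset_left (hg C hCP)
        (Finset.disjoint_of_subset_right (hg C' hC'P) (h.disj C hCP C' hC'P hne))

/-- exceptional sets -/
def Exc (C : Finset V) : Prop := 4 * f G C = C.card + 1

/-- The induction claim. -/
def Claim (T : Finset V) : Prop :=
  4 * f G T ≤ T.card + 1 ∧ (Exc G T → ∀ y ∈ T, f G (T.erase y) + 1 ≤ f G T)

lemma key {P : Finset (Finset V)} {S S' D : Finset V} (hP : Parts G P S')
    (hD : ∀ z ∈ S, z ∉ S' → ∃ d ∈ D, Dom G d z)
    (hB : ∀ C ∈ P, Claim G C)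
    (E : Finset (Finset V)) (hE : ∀ C ∈ E, C ∈ P ∧ Exc G C ∧ ∃ y ∈ C, ∃ d ∈ D, Dom G d y) :
    4 * f G S + 4 * E.card ≤ 4 * D.card + S'.card + (P.filter (Exc G)).card := by
  have hy : ∀ C, ∃ T ⊆ C, (C ∈ P → f G T + (if C ∈ E then 1 else 0) ≤ f G C) ∧
      ∀ z ∈ C, z ∉ T → ∃ d ∈ D, Dom G d z := by
    intro C
    by_cases hC : C ∈ E
    · obtain ⟨h1, h2, y, hy, d, hd, hdy⟩ := hE C hC
      refine ⟨C.erase y, Finset.erase_subset _ _, fun _ => ?_, ?_⟩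
      · rw [if_pos hC]; exact (hB C h1).2 h2 y hy
      · intro z hz hz'
        have : z = y := by
          by_contra hne
          exact hz' (Finset.mem_erase.2 ⟨hne, hz⟩)
        exact ⟨d, hd, this ▸ hdy⟩
    · exact ⟨C, subset_rfl, by simp [hC], fun z hz hz' => absurd hz hz'⟩
  choose g hg1 hg2 hg3 using hy
  have h1 : f G S ≤ D.card + f G (P.biUnion g) := by
    apply f_dom
    intro z hz hz'
    by_cases hzS : z ∈ S'
    · rw [← hP.union] at hzS
      obtain ⟨C, hC, hzC⟩ := Finset.mem_biUnion.1 hzS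
      exact hg3 C z hzC fun h => hz' (Finset.mem_biUnion.2 ⟨C, hC, h⟩)
    · exact hD z hz hzS
  have h2 := f_biUnion G hP g (fun C _ => hg1 C) P subset_rfl
  have h3 : ∑ C ∈ P, (4 * f G (g C) + 4 * (if C ∈ E then 1 else 0)) ≤
      ∑ C ∈ P, (C.card + if Exc G C then 1 else 0) := by
    apply Finset.sum_le_sum
    intro C hC
    have a := hg2 C hC
    have b := (hB C hC).1
    by_cases hx : Exc G C
    · rw [if_pos hx]; omega
    · rw [if_neg hx]
      have : 4 * f G C ≠ C.card + 1 := hx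
      omega
  rw [Finset.sum_add_distrib, Finset.sum_add_distrib, ← Finset.mul_sum, ← Finset.mul_sum,
    ← hP.card, ← Finset.card_filter, ← Finset.card_filter] at h3
  have h4 : P.filter (· ∈ E) = E := by
    ext C
    simp only [Finset.mem_filter]
    exact ⟨fun h => h.2, fun h => ⟨(hE C h).1, h⟩⟩
  rw [h4] at h3
  change _ + 4 * _ ≤ S'.card + (P.filter (Exc G)).card at h3
  omega

lemma parts_unique {P : Finset (Finset V)} {S C : Finset V} (hP : Parts G P S)
    (hC : Conn G C) (hCS : C ⊆ S) (hcl : ∀ a ∈ C, ∀ b ∈ S, G.Adj a b → b ∈ C) : C ∈ P := by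
  obtain ⟨c, hc⟩ := hC.1
  have hcS := hCS hc
  rw [← hP.union] at hcS
  obtain ⟨C', hC', hcC'⟩ := Finset.mem_biUnion.1 hcS
  simp only [id] at hcC'
  have h1 : C ∩ C' = C' := by
    by_contra hne
    obtain ⟨a, ha, b, hb, hb', hab⟩ := (hP.conn C' hC').2 (C ∩ C') Finset.inter_subset_right
      ⟨c, Finset.mem_inter.2 ⟨hc, hcC'⟩⟩ hne
    exact hb' (Finset.mem_inter.2 ⟨hcl a (Finset.mem_inter.1 ha).1 b (hP.sub C' hC' hb) hab, hb⟩)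
  have h2 : C ∩ C' = C := by
    by_contra hne
    obtain ⟨a, ha, b, hb, hb', hab⟩ := hC.2 (C ∩ C') Finset.inter_subset_left
      ⟨c, Finset.mem_inter.2 ⟨hc, hcC'⟩⟩ hne
    exact hb' (Finset.mem_inter.2 ⟨hb, hP.closed C' hC' a (Finset.mem_inter.1 ha).2 b (hCS hb) hab⟩)
  have : C = C' := h2.symm.trans h1
  exact this ▸ hC'

/-- every component of `S'` has an edge to `S \ S'` -/
lemma exists_link {P : Finset (Finset V)} {S S' C : Finset V} (hS : Conn G S)
    (hSS : S' ⊂ S) (hP : Parts G P S') (hC : C ∈ P) :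
    ∃ x ∈ S, x ∉ S' ∧ ∃ y ∈ C, G.Adj x y := by
  have hCS := hP.sub C hC
  obtain ⟨a, ha, b, hb, hbC, hab⟩ := hS.2 C (hCS.trans hSS.1) (hP.conn C hC).1 (by
    rintro rfl; exact hSS.2 hCS)
  exact ⟨b, hb, fun h => hbC (hP.closed C hC a ha b h hab), a, ha, hab.symm⟩

/-- Claim for all smaller connected sets. -/
def Below (S : Finset V) : Prop := ∀ T, T ⊂ S → Conn G T → Claim G T

lemma below_parts {P : Finset (Finset V)} {S S' : Finset V} (hB : Below G S)
    (hSS : S' ⊂ S) (hP : Parts G P S') : ∀ C ∈ P, Claim G C := fun C hC =>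
  hB C (Finset.ssubset_of_subset_of_ssubset (hP.sub C hC) hSS) (hP.conn C hC)

lemma cut {S C : Finset V} {x : V} (hS : Conn G S) (hB : Below G S) (hx : x ∈ S)
    (hC : Conn G C) (hCS : C ⊆ S.erase x) (hcl : ∀ a ∈ C, ∀ b ∈ S.erase x, G.Adj a b → b ∈ C)
    (hE : Exc G C) : 4 * f G S ≤ S.card := by
  obtain ⟨P, hP⟩ := exists_parts G (S.erase x)
  have hCP := parts_unique G hP hC hCS hcl
  have hss := Finset.erase_ssubset hx
  have := key G (S := S) (D := {x}) hP (by
    intro z hz hz'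
    refine ⟨x, by simp, Or.inl ?_⟩
    by_contra hne
    exact hz' (Finset.mem_erase.2 ⟨hne, hz⟩)) (below_parts G hB hss hP) (P.filter (Exc G)) (by
    intro C hC
    have hC := Finset.mem_filter.1 hC
    refine ⟨hC.1, hC.2, ?_⟩
    obtain ⟨x', hx', hx'', y, hy, hxy⟩ := exists_link G hS hss hP hC.1
    have : x' = x := by
      by_contra hne
      exact hx'' (Finset.mem_erase.2 ⟨hne, hx'⟩)
    exact ⟨y, hy, x, by simp, Or.inr (this ▸ hxy)⟩)
  have h1 : 0 < (P.filter (Exc G)).card :=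
    Finset.card_pos.2 ⟨C, Finset.mem_filter.2 ⟨hCP, hE⟩⟩
  rw [Finset.card_erase_of_mem hx, Finset.card_singleton] at this
  have : 0 < S.card := Finset.card_pos.2 ⟨x, hx⟩
  omega

lemma del {S : Finset V} (hS : Conn G S) (hB : Below G S) (hE : Exc G S) :
    ∀ y ∈ S, f G (S.erase y) + 1 ≤ f G S := by
  intro y hy
  obtain ⟨P, hP⟩ := exists_parts G (S.erase y)
  have hss := Finset.erase_ssubset hy
  have h := key G (S := S.erase y) (D := ∅) hP (by intro z hz hz'; exact absurd hz hz')
    (below_parts G hB hss hP) ∅ (by simp)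
  have h0 : P.filter (Exc G) = ∅ := by
    rw [Finset.eq_empty_iff_forall_notMem]
    intro C hC
    have hC := Finset.mem_filter.1 hC
    have := cut G hS hB hy (hP.conn C hC.1) (hP.sub C hC.1) (hP.closed C hC.1) hC.2
    unfold Exc at hE
    omega
  rw [h0, Finset.card_erase_of_mem hy] at h
  unfold Exc at hE
  simp at h
  omega

/-- neighbourhood of `v` in `S` -/
noncomputable def nb (S : Finset V) (v : V) : Finset V := S.filter (G.Adj v)

/-- `S` minus closed neighbourhood of `v`. -/
noncomputable def rest (S : Finset V) (v : V) : Finset V := S.filter (fun z => ¬ Dom G v z)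

lemma rest_card {S : Finset V} {v : V} (hv : v ∈ S) :
    (rest G S v).card + (nb G S v).card + 1 = S.card := by
  have h1 : S.filter (Dom G v) = insert v (nb G S v) := by
    ext z
    simp only [Finset.mem_filter, Finset.mem_insert, nb, Dom]
    constructor
    · tauto
    · rintro (rfl | h)
      · tauto
      · tauto
  have h2 := Finset.card_filter_add_card_filter_not (s := S) (Dom G v)
  rw [h1, Finset.card_insert_of_notMem (by simp [nb])] at h2
  unfold rest
  omega

lemma rest_ssubset {S : Finset V} {v : V} (hv : v ∈ S) : rest G S v ⊂ S :=
  Finset.filter_ssubset.2 ⟨v, hv, by simp [Dom]⟩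

/-- vertices of `N(v)` linked to `C` -/
noncomputable def lk (S : Finset V) (v : V) (C : Finset V) : Finset V :=
  (nb G S v).filter (fun x => ∃ y ∈ C, G.Adj x y)

lemma lk_card {P : Finset (Finset V)} {S : Finset V} {v : V} (hS : Conn G S) (hB : Below G S)
    (hv : v ∈ S) (hP : Parts G P (rest G S v)) (hbad : S.card < 4 * f G S) :
    ∀ C ∈ P, Exc G C → 2 ≤ (lk G S v C).card := by
  intro C hC hE
  have hss := rest_ssubset G hv
  have link : ∀ a ∈ C, ∀ b ∈ S, G.Adj a b → b ∉ C → b ∈ lk G S v C := by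
    intro a ha b hb hab hbC
    have h1 : Dom G v b := by
      by_contra h
      exact hbC (hP.closed C hC a ha b (Finset.mem_filter.2 ⟨hb, h⟩) hab)
    have h2 : b ≠ v := by
      rintro rfl
      have := (Finset.mem_filter.1 (hP.sub C hC ha)).2
      exact this (Or.inr hab.symm)
    have h3 : G.Adj v b := h1.resolve_left h2
    exact Finset.mem_filter.2 ⟨Finset.mem_filter.2 ⟨hb, h3⟩, a, ha, hab.symm⟩
  by_contra hlt
  have h1 : (lk G S v C).Nonempty := by
    obtain ⟨x, hx, hx', y, hy, hxy⟩ := exists_link G hS hss hP hC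
    exact ⟨x, link y hy x hx hxy.symm fun h => hx' (hP.sub C hC h)⟩
  have h2 : (lk G S v C).card = 1 := by
    have := Finset.card_pos.2 h1
    omega
  obtain ⟨x, hx⟩ := Finset.card_eq_one.1 h2
  have hxl : x ∈ lk G S v C := by simp [hx]
  have hx1 := Finset.mem_filter.1 (Finset.mem_filter.1 hxl).1
  have := cut G hS hB hx1.1 (hP.conn C hC) (by
    intro z hz
    have hz' := Finset.mem_filter.1 (hP.sub C hC hz)
    refine Finset.mem_erase.2 ⟨?_, hz'.1⟩
    rintro rfl
    exact hz'.2 (Or.inr hx1.2)) (by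
    intro a ha b hb hab
    by_contra hbC
    have hb' := Finset.mem_erase.1 hb
    have := link a ha b hb'.2 hab hbC
    rw [hx, Finset.mem_singleton] at this
    exact hb'.1 this) hE
  omega

lemma key2 {P : Finset (Finset V)} {S : Finset V} {v : V} (hB : Below G S)
    (hv : v ∈ S) (hP : Parts G P (rest G S v)) (X : Finset V) (hX : X ⊆ nb G S v) :
    4 * f G S + 4 * ((P.filter (Exc G)).filter fun C => (X ∩ lk G S v C).Nonempty).card +
      (nb G S v).card ≤ 3 + 4 * X.card + S.card + (P.filter (Exc G)).card := by
  have h := key G (S := S) (D := insert v X) hP (by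
    intro z hz hz'
    refine ⟨v, by simp, ?_⟩
    by_contra h
    exact hz' (Finset.mem_filter.2 ⟨hz, h⟩)) (below_parts G hB (rest_ssubset G hv) hP)
    ((P.filter (Exc G)).filter fun C => (X ∩ lk G S v C).Nonempty) (by
    intro C hC
    obtain ⟨h1, x, hx⟩ := Finset.mem_filter.1 hC
    obtain ⟨h1, h2⟩ := Finset.mem_filter.1 h1
    obtain ⟨hx1, hx2⟩ := Finset.mem_inter.1 hx
    obtain ⟨y, hy, hxy⟩ := (Finset.mem_filter.1 hx2).2
    exact ⟨h1, h2, y, hy, x, by simp [hx1], Or.inr hxy⟩)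
  rw [Finset.card_insert_of_notMem (by
    intro h
    have := (Finset.mem_filter.1 (hX h)).2
    exact G.loopless.irrefl _ this)] at h
  have := rest_card G hv
  omega

lemma main_deg {S : Finset V} {v : V} (hS : Conn G S) (hB : Below G S) (hv : v ∈ S)
    (hd : 3 ≤ (nb G S v).card) :
    4 * f G S ≤ S.card + 1 ∧ (5 ≤ (nb G S v).card → 4 * f G S ≤ S.card) := by
  by_cases hbad : S.card < 4 * f G S
  swap
  · omega
  obtain ⟨P, hP⟩ := exists_parts G (rest G S v)
  have hl := lk_card G hS hB hv hP hbad
  have h1 := key2 G hB hv hP ∅ (by simp)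
  set E := P.filter (Exc G) with hEdef
  set N := nb G S v with hN
  have hl' : ∀ C ∈ E, 2 ≤ (lk G S v C).card := fun C hC =>
    hl C (Finset.mem_filter.1 hC).1 (Finset.mem_filter.1 hC).2
  have hlN : ∀ C, lk G S v C ⊆ N := fun C => Finset.filter_subset _ _
  -- case (iii)
  have h3 : E.card < N.card := by
    by_contra hge
    obtain ⟨x0, hx0⟩ : N.Nonempty := Finset.card_pos.1 (by omega)
    have h3 := key2 G hB hv hP (N.erase x0) (Finset.erase_subset _ _)
    have : (E.filter fun C => ((N.erase x0) ∩ lk G S v C).Nonempty) = E := by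
      apply Finset.filter_true_of_mem
      intro C hC
      obtain ⟨x, hx, hne⟩ := Finset.exists_mem_ne (by have := hl' C hC; omega : 1 < (lk G S v C).card) x0
      exact ⟨x, Finset.mem_inter.2 ⟨Finset.mem_erase.2 ⟨hne, hlN C hx⟩, hx⟩⟩
    rw [← hEdef, ← hN, this, Finset.card_erase_of_mem hx0] at h3
    omega
  -- no vertex covers two
  have h2 : ∀ x ∈ N, (E.filter fun C => x ∈ lk G S v C).card ≤ 1 := by
    intro x hx
    have h2 := key2 G hB hv hP {x} (by simpa using hx)
    have : (E.filter fun C => (({x} : Finset V) ∩ lk G S v C).Nonempty) =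
        (E.filter fun C => x ∈ lk G S v C) := by
      apply Finset.filter_congr
      intro C _
      constructor
      · rintro ⟨y, hy⟩
        simp only [Finset.mem_inter, Finset.mem_singleton] at hy
        exact hy.1 ▸ hy.2
      · intro h
        exact ⟨x, by simp [h]⟩
    rw [← hEdef, ← hN, this, Finset.card_singleton] at h2
    omega
  have h4 : 2 * E.card ≤ N.card := by
    have := Finset.sum_card_bipartiteAbove_eq_sum_card_bipartiteBelow (s := N) (t := E)
      (fun x C => x ∈ lk G S v C)
    have a : ∑ x ∈ N, (E.bipartiteAbove (fun x C => x ∈ lk G S v C) x).card ≤ ∑ x ∈ N, 1 :=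
      Finset.sum_le_sum h2
    have b : ∑ C ∈ E, 2 ≤ ∑ C ∈ E, (N.bipartiteBelow (fun x C => x ∈ lk G S v C) C).card := by
      apply Finset.sum_le_sum
      intro C hC
      have : N.bipartiteBelow (fun x C => x ∈ lk G S v C) C = lk G S v C := by
        ext x
        simp only [Finset.bipartiteBelow, Finset.mem_filter]
        exact ⟨fun h => h.2, fun h => ⟨hlN C h, h⟩⟩
      rw [this]
      exact hl' C hC
    simp at a b
    omega
  simp at h1
  omega

lemma hasC6 {p0 p1 p2 p3 p4 p5 : V} (h01 : G.Adj p0 p1) (h12 : G.Adj p1 p2) (h23 : G.Adj p2 p3)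
    (h34 : G.Adj p3 p4) (h45 : G.Adj p4 p5) (h50 : G.Adj p0 p5)
    (n02 : ¬ G.Adj p0 p2) (n03 : ¬ G.Adj p0 p3) (n04 : ¬ G.Adj p0 p4)
    (n13 : ¬ G.Adj p1 p3) (n14 : ¬ G.Adj p1 p4) (n15 : ¬ G.Adj p1 p5)
    (n24 : ¬ G.Adj p2 p4) (n25 : ¬ G.Adj p2 p5) (n35 : ¬ G.Adj p3 p5) : HasInducedC6 G := by
  let g : Fin 6 → V := ![p0, p1, p2, p3, p4, p5]
  have hg : ∀ a b, G.Adj (g a) (g b) ↔ (SimpleGraph.cycleGraph 6).Adj a b := by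
    have hlt : ∀ a b : Fin 6, a < b → (G.Adj (g a) (g b) ↔ (SimpleGraph.cycleGraph 6).Adj a b) := by
      intro a b hab
      have hc : (SimpleGraph.cycleGraph 6).Adj a b ↔ (b.val = a.val + 1 ∨ (a = 0 ∧ b = 5)) := by
        revert a b; decide
      rw [hc]
      fin_cases a <;> fin_cases b <;> first | (exact absurd hab (by decide)) | simp [g, *]
    intro a b
    rcases lt_trichotomy a b with h | h | h
    · exact hlt a b h
    · subst h; simp
    · rw [G.adj_comm, (SimpleGraph.cycleGraph 6).adj_comm]; exact hlt b a h
  refine ⟨⟨g, ?_⟩, hg⟩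
  intro a b hab
  have h : ∀ k, (SimpleGraph.cycleGraph 6).Adj a k ↔ (SimpleGraph.cycleGraph 6).Adj b k := by
    intro k
    rw [← hg, ← hg, hab]
  revert a b
  have : ∀ a b : Fin 6, (∀ k, (SimpleGraph.cycleGraph 6).Adj a k ↔
      (SimpleGraph.cycleGraph 6).Adj b k) → a = b := by decide
  intro a b _ h
  exact this a b h

lemma deg2 {S : Finset V} {v p q r : V} (h : (nb G S v).card ≤ 2) (hp : p ∈ S) (hq : q ∈ S)
    (hpq : p ≠ q) (hvp : G.Adj v p) (hvq : G.Adj v q) (hr : r ∈ S) (hvr : G.Adj v r) :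
    r = p ∨ r = q := by
  by_contra hne
  push Not at hne
  have h1 : ({p, q, r} : Finset V) ⊆ nb G S v := by
    intro z hz
    simp at hz
    rcases hz with rfl | rfl | rfl <;> simp [nb, *]
  have h2 := Finset.card_le_card h1
  rw [Finset.card_eq_three.mpr ⟨p, q, r, hpq, hne.1.symm, hne.2.symm, rfl⟩] at h2
  omega

lemma main_two {S : Finset V} (hS : Conn G S) (hB : Below G S) (h6 : ¬ HasInducedC6 G)
    (hd : ∀ v ∈ S, (nb G S v).card ≤ 2) : 4 * f G S ≤ S.card + 1 := by
  by_contra hbad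
  push Not at hbad
  have hS3 : 2 < S.card := by
    by_contra h
    have := f_small G (S := S) (by omega)
    omega
  -- a vertex of degree two
  obtain ⟨v, hv, x1, hx1, x2, hx2, hx12, hvx1, hvx2⟩ : ∃ v ∈ S, ∃ x1 ∈ S, ∃ x2 ∈ S, x1 ≠ x2 ∧
      G.Adj v x1 ∧ G.Adj v x2 := by
    obtain ⟨a, ha⟩ := hS.1
    obtain ⟨a', ha', b, hb, hba, hab⟩ := hS.2 {a} (by simpa using ha) (by simp) (by
      rintro rfl; simp at hS3)
    simp at ha' hba
    subst ha'
    obtain ⟨y, hy, c, hc, hcy, hyc⟩ := hS.2 {a', b} (by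
      intro z hz; simp at hz; rcases hz with rfl | rfl <;> assumption) (by simp) (by
      intro h
      have := Finset.card_le_two (a := a') (b := b)
      rw [h] at this; omega)
    simp at hy hcy
    rcases hy with rfl | rfl
    · exact ⟨y, ha, b, hb, c, hc, fun h => hcy.2 h.symm, hab, hyc⟩
    · exact ⟨y, hb, a', ha, c, hc, fun h => hcy.1 h.symm, hab.symm, hyc⟩
  have nv : ∀ r ∈ S, G.Adj v r → r = x1 ∨ r = x2 := fun r hr h =>
    deg2 G (hd v hv) hx1 hx2 hx12 hvx1 hvx2 hr h
  have hnb : nb G S v = {x1, x2} := by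
    ext z
    simp only [nb, Finset.mem_filter, Finset.mem_insert, Finset.mem_singleton]
    constructor
    · exact fun h => nv z h.1 h.2
    · rintro (rfl | rfl) <;> simp [*]
  have hnbc : (nb G S v).card = 2 := by rw [hnb, Finset.card_pair hx12]
  obtain ⟨P, hP⟩ := exists_parts G (rest G S v)
  have hl := lk_card G hS hB hv hP (by omega)
  have h1 := key2 G hB hv hP ∅ (by simp)
  obtain ⟨C, hC⟩ : (P.filter (Exc G)).Nonempty := by
    rw [← Finset.card_pos]
    simp at h1
    omega
  obtain ⟨hC, hE⟩ := Finset.mem_filter.1 hC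
  have hlC : lk G S v C = nb G S v :=
    Finset.eq_of_subset_of_card_le (Finset.filter_subset _ _) (by rw [hnbc]; exact hl C hC hE)
  have hC3 : 3 ≤ C.card := by
    unfold Exc at hE
    omega
  have hC4 : C.card ≠ 4 := by
    unfold Exc at hE
    omega
  obtain ⟨c1, hc1, hxc1⟩ : ∃ y ∈ C, G.Adj x1 y := by
    have : x1 ∈ lk G S v C := by rw [hlC, hnb]; simp
    exact (Finset.mem_filter.1 this).2
  obtain ⟨c2, hc2, hxc2⟩ : ∃ y ∈ C, G.Adj x2 y := by
    have : x2 ∈ lk G S v C := by rw [hlC, hnb]; simp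
    exact (Finset.mem_filter.1 this).2
  have hCS : ∀ z ∈ C, z ∈ S ∧ z ≠ v ∧ ¬ G.Adj v z := by
    intro z hz
    have := Finset.mem_filter.1 (hP.sub C hC hz)
    unfold Dom at this
    tauto
  have hvC : v ∉ C := fun h => (hCS v h).2.1 rfl
  have hx1C : x1 ∉ C := fun h => (hCS x1 h).2.2 hvx1
  have hx2C : x2 ∉ C := fun h => (hCS x2 h).2.2 hvx2
  have ne_of : ∀ y z : V, y ∉ C → z ∈ C → y ≠ z := by
    rintro y z hy hz rfl; exact hy hz
  have n1 : ∀ r ∈ S, G.Adj x1 r → r = v ∨ r = c1 := fun r hr h =>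
    deg2 G (hd x1 hx1) hv (hCS c1 hc1).1 (ne_of _ _ hvC hc1) hvx1.symm hxc1 hr h
  have n2 : ∀ r ∈ S, G.Adj x2 r → r = v ∨ r = c2 := fun r hr h =>
    deg2 G (hd x2 hx2) hv (hCS c2 hc2).1 (ne_of _ _ hvC hc2) hvx2.symm hxc2 hr h
  have hCc := (hP.conn C hC).2
  have hCS' : ∀ z ∈ C, z ∈ S := fun z hz => (hCS z hz).1
  -- c1 and a
  obtain ⟨c1', hc1', a, ha, hac1, hc1a⟩ := hCc {c1} (by simpa using hc1) (by simp) (by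
    intro h; rw [← h] at hC3; simp at hC3)
  simp only [Finset.mem_singleton] at hc1' hac1
  subst hc1'
  have nc1 : ∀ r ∈ S, G.Adj c1' r → r = x1 ∨ r = a := fun r hr h =>
    deg2 G (hd c1' (hCS' _ hc1)) hx1 (hCS' _ ha) (ne_of _ _ hx1C ha) hxc1.symm hc1a hr h
  have hc12 : c1' ≠ c2 := by
    rintro rfl
    rcases nc1 x2 hx2 hxc2.symm with h | h
    · exact hx12 h.symm
    · exact hx2C (h ▸ ha)
  -- b
  obtain ⟨y, hy, b, hb, hby, hyb⟩ := hCc {c1', a} (by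
      intro z hz; simp at hz; rcases hz with rfl | rfl <;> assumption) (by simp) (by
      intro h
      have := Finset.card_le_two (a := c1') (b := a)
      rw [h] at this; omega)
  simp only [Finset.mem_insert, Finset.mem_singleton, not_or] at hy hby
  have hy : y = a := by
    rcases hy with rfl | rfl
    · rcases nc1 b (hCS' _ hb) hyb with h | h
      · exact absurd (h ▸ hb) hx1C
      · exact absurd h hby.2
    · rfl
  subst hy
  have na : ∀ r ∈ S, G.Adj y r → r = c1' ∨ r = b := fun r hr h =>
    deg2 G (hd y (hCS' _ ha)) (hCS' _ hc1) (hCS' _ hb) (fun h => hby.1 h.symm) hc1a.symm hyb hr h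
  have hac2 : y ≠ c2 := by
    rintro rfl
    rcases na x2 hx2 hxc2.symm with h | h
    · exact hx2C (h ▸ hc1)
    · exact hx2C (h ▸ hb)
  by_cases hbc2 : b = c2
  · subst hbc2
    have nb' : ∀ r ∈ S, G.Adj b r → r = x2 ∨ r = y := fun r hr h =>
      deg2 G (hd b (hCS' _ hb)) hx2 (hCS' _ ha) (ne_of _ _ hx2C ha) hxc2.symm hyb.symm hr h
    apply h6
    refine hasC6 G hvx1 hxc1 hc1a hyb hxc2.symm hvx2 (hCS _ hc1).2.2 (hCS _ ha).2.2 (hCS _ hb).2.2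
      ?_ ?_ ?_ ?_ ?_ ?_
    · intro h
      rcases n1 _ (hCS' _ ha) h with h | h
      · exact hvC (h ▸ ha)
      · exact hac1 h
    · intro h
      rcases n1 _ (hCS' _ hb) h with h | h
      · exact hvC (h ▸ hb)
      · exact hby.1 h
    · intro h
      rcases n1 _ hx2 h with h | h
      · exact hvx2.ne h.symm
      · exact hx2C (h ▸ hc1)
    · intro h
      rcases nc1 _ (hCS' _ hb) h with h | h
      · exact hx1C (h ▸ hb)
      · exact hby.2 h
    · intro h
      rcases nc1 _ hx2 h with h | h
      · exact hx12 h.symm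
      · exact hx2C (h ▸ ha)
    · intro h
      rcases na _ hx2 h with h | h
      · exact hx2C (h ▸ hc1)
      · exact hx2C (h ▸ hb)
  -- w
  obtain ⟨y', hy', w, hw, hwy, hyw⟩ := hCc {c1', y, b} (by
      intro z hz; simp at hz; rcases hz with rfl | rfl | rfl <;> assumption) (by simp) (by
      intro h
      rw [← h] at hc2
      simp only [Finset.mem_insert, Finset.mem_singleton] at hc2
      rcases hc2 with h | h | h
      · exact hc12 h.symm
      · exact hac2 h.symm
      · exact hbc2 h.symm)
  simp only [Finset.mem_insert, Finset.mem_singleton, not_or] at hy' hwy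
  have hy' : y' = b := by
    rcases hy' with rfl | rfl | rfl
    · rcases nc1 w (hCS' _ hw) hyw with h | h
      · exact absurd (h ▸ hw) hx1C
      · exact absurd h hwy.2.1
    · rcases na w (hCS' _ hw) hyw with h | h
      · exact absurd h hwy.1
      · exact absurd h hwy.2.2
    · rfl
  subst hy'
  have nb' : ∀ r ∈ S, G.Adj y' r → r = y ∨ r = w := fun r hr h =>
    deg2 G (hd y' (hCS' _ hb)) (hCS' _ ha) (hCS' _ hw) (fun h => hwy.2.1 h.symm) hyb.symm hyw hr h
  -- u
  obtain ⟨w', hw', u, hu, huw, hwu⟩ := hCc {c1', y, y', w} (by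
      intro z hz; simp at hz; rcases hz with rfl | rfl | rfl | rfl <;> assumption) (by simp) (by
      intro h
      apply hC4
      rw [← h, Finset.card_insert_of_notMem, Finset.card_insert_of_notMem, Finset.card_pair]
      · exact fun h => hwy.2.2 h.symm
      · simp only [Finset.mem_insert, Finset.mem_singleton, not_or]
        exact ⟨hyb.ne, fun h => hwy.2.1 h.symm⟩
      · simp only [Finset.mem_insert, Finset.mem_singleton, not_or]
        exact ⟨hc1a.ne, fun h => hby.1 h.symm, fun h => hwy.1 h.symm⟩)
  simp only [Finset.mem_insert, Finset.mem_singleton, not_or] at hw' huw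
  have hw' : w' = w := by
    rcases hw' with rfl | rfl | rfl | rfl
    · rcases nc1 u (hCS' _ hu) hwu with h | h
      · exact absurd (h ▸ hu) hx1C
      · exact absurd h huw.2.1
    · rcases na u (hCS' _ hu) hwu with h | h
      · exact absurd h huw.1
      · exact absurd h huw.2.2.1
    · rcases nb' u (hCS' _ hu) hwu with h | h
      · exact absurd h huw.2.1
      · exact absurd h huw.2.2.2
    · rfl
  subst hw'
  have nw : ∀ r ∈ S, G.Adj w' r → r = y' ∨ r = u := fun r hr h =>
    deg2 G (hd w' (hCS' _ hw)) (hCS' _ hb) (hCS' _ hu) (fun h => huw.2.2.1 h.symm) hyw.symm hwu hr h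
  -- the final count
  set X : Finset V := {v, x1, x2, c1', y, y', w', u} with hX
  have hXS : X ⊆ S := by
    intro z hz
    simp only [hX, Finset.mem_insert, Finset.mem_singleton] at hz
    rcases hz with rfl | rfl | rfl | rfl | rfl | rfl | rfl | rfl
    all_goals first | assumption | (apply hCS'; assumption)
  have hXc : X.card = 8 := by
    rw [hX]
    have e1 := ne_of _ _ hvC hc1
    have e2 := ne_of _ _ hvC ha
    have e3 := ne_of _ _ hvC hb
    have e4 := ne_of _ _ hvC hw
    have e5 := ne_of _ _ hvC hu
    have f1 := ne_of _ _ hx1C hc1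
    have f2 := ne_of _ _ hx1C ha
    have f3 := ne_of _ _ hx1C hb
    have f4 := ne_of _ _ hx1C hw
    have f5 := ne_of _ _ hx1C hu
    have g1 := ne_of _ _ hx2C hc1
    have g2 := ne_of _ _ hx2C ha
    have g3 := ne_of _ _ hx2C hb
    have g4 := ne_of _ _ hx2C hw
    have g5 := ne_of _ _ hx2C hu
    have k1 := hvx1.ne
    have k2 := hvx2.ne
    obtain ⟨m1, m2⟩ := hby
    obtain ⟨m3, m4, m5⟩ := hwy
    obtain ⟨m6, m7, m8, m9⟩ := huw
    repeat rw [Finset.card_insert_of_notMem]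
    · simp
    all_goals
      simp only [Finset.mem_insert, Finset.mem_singleton, not_or]
      grind
  have hbound : f G S ≤ 2 + f G (S \ X) := by
    have a1 := f_dom G (S := S) (D := {v, w'}) (S' := {c1', y} ∪ (S \ X)) (by
      intro z hz hz'
      simp only [hX, Finset.mem_union, Finset.mem_sdiff, Finset.mem_insert, Finset.mem_singleton] at hz'
      push Not at hz'
      have hz2 := hz'.2 hz
      rcases hz2 with rfl | rfl | rfl | rfl | rfl | rfl | rfl | rfl
      · exact ⟨z, by simp, Or.inl rfl⟩
      · exact ⟨v, by simp, Or.inr hvx1⟩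
      · exact ⟨v, by simp, Or.inr hvx2⟩
      · exact absurd rfl hz'.1.1
      · exact absurd rfl hz'.1.2
      · exact ⟨w', by simp, Or.inr hyw.symm⟩
      · exact ⟨z, by simp, Or.inl rfl⟩
      · exact ⟨w', by simp, Or.inr hwu⟩)
    have a2 := f_union G (A := {c1', y}) (B := S \ X) (by
      intro p hp q hq hpq
      obtain ⟨hqS, hqX⟩ := Finset.mem_sdiff.1 hq
      apply hqX
      simp only [Finset.mem_insert, Finset.mem_singleton] at hp
      rcases hp with rfl | rfl
      · rcases nc1 q hqS hpq with rfl | rfl <;> simp [hX]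
      · rcases na q hqS hpq with rfl | rfl <;> simp [hX]) (by
      rw [Finset.disjoint_left]
      intro p hp hq
      apply (Finset.mem_sdiff.1 hq).2
      simp only [Finset.mem_insert, Finset.mem_singleton] at hp
      rcases hp with rfl | rfl <;> simp [hX])
    have a3 := f_small G (S := {c1', y}) Finset.card_le_two
    have a4 := Finset.card_le_two (a := v) (b := w')
    omega
  have hss : S \ X ⊂ S := Finset.sdiff_ssubset hXS ⟨v, by simp [hX]⟩
  obtain ⟨Q, hQ⟩ := exists_parts G (S \ X)
  have h2 := key G (S := S \ X) (D := ∅) hQ (by intro z hz hz'; exact absurd hz hz')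
    (below_parts G hB hss hQ) ∅ (by simp)
  have hcov : ∀ K ∈ Q, Exc G K → c2 ∈ K := by
    intro K hK hKE
    by_contra hcK
    have hKS : ∀ z ∈ K, z ∈ S ∧ z ∉ X := fun z hz => Finset.mem_sdiff.1 (hQ.sub K hK hz)
    have := cut G hS hB (hCS' _ hu) (hQ.conn K hK) (by
      intro z hz
      refine Finset.mem_erase.2 ⟨?_, (hKS z hz).1⟩
      rintro rfl
      exact (hKS z hz).2 (by simp [hX])) (by
      intro p hp q hq hpq
      obtain ⟨hqu, hqS⟩ := Finset.mem_erase.1 hq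
      obtain ⟨hpS, hpX⟩ := hKS p hp
      by_cases hqX : q ∈ X
      · exfalso
        simp only [hX, Finset.mem_insert, Finset.mem_singleton] at hqX
        have hqp := hpq.symm
        rcases hqX with rfl | rfl | rfl | rfl | rfl | rfl | rfl | rfl
        · rcases nv p hpS hqp with rfl | rfl <;> exact hpX (by simp [hX])
        · rcases n1 p hpS hqp with rfl | rfl <;> exact hpX (by simp [hX])
        · rcases n2 p hpS hqp with rfl | rfl
          · exact hpX (by simp [hX])
          · exact hcK hp
        · rcases nc1 p hpS hqp with rfl | rfl <;> exact hpX (by simp [hX])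
        · rcases na p hpS hqp with rfl | rfl <;> exact hpX (by simp [hX])
        · rcases nb' p hpS hqp with rfl | rfl <;> exact hpX (by simp [hX])
        · rcases nw p hpS hqp with rfl | rfl <;> exact hpX (by simp [hX])
        · exact hqu rfl
      · exact hQ.closed K hK p hp q (Finset.mem_sdiff.2 ⟨hqS, hqX⟩) hpq) hKE
    omega
  have he : (Q.filter (Exc G)).card ≤ 1 := by
    rw [Finset.card_le_one]
    intro K hK K' hK'
    obtain ⟨hK, hKE⟩ := Finset.mem_filter.1 hK
    obtain ⟨hK', hKE'⟩ := Finset.mem_filter.1 hK'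
    by_contra hne
    exact Finset.disjoint_left.1 (hQ.disj K hK K' hK' hne) (hcov K hK hKE) (hcov K' hK' hKE')
  have hcard := Finset.card_sdiff_add_card_eq_card hXS
  simp at h2
  omega

lemma claim_all (h6 : ¬ HasInducedC6 G) (S : Finset V) : Conn G S → Claim G S := by
  induction S using Finset.strongInduction with
  | H S ih =>
    intro hS
    have hB : Below G S := fun T hT hc => ih T hT hc
    refine ⟨?_, fun hE => del G hS hB hE⟩
    by_cases h : ∃ v ∈ S, 3 ≤ (nb G S v).card
    · obtain ⟨v, hv, h3⟩ := h
      exact (main_deg G hS hB hv h3).1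
    · push Not at h
      exact main_two G hS hB h6 fun v hv => by have := h v hv; omega

lemma conn_univ [Fintype V] (hc : G.Connected) : Conn G (Finset.univ : Finset V) := by
  have hp := hc.preconnected
  obtain ⟨v0⟩ := hc.nonempty
  refine ⟨⟨v0, by simp⟩, ?_⟩
  intro T _ hT hne
  by_contra hno
  push Not at hno
  obtain ⟨a, ha⟩ := hT
  apply hne
  rw [Finset.eq_univ_iff_forall]
  intro z
  obtain ⟨p⟩ := hp a z
  induction p with
  | nil => exact ha
  | cons h p ih =>
    apply ih
    by_contra hb
    exact hno _ ha _ (Finset.mem_univ _) hb h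

end P3Iso

theorem stmt_13 {V : Type*} [Fintype V] (G : SimpleGraph V)
    (hc : G.Connected) (h6 : ¬ HasInducedC6 G)
    (hdeg : ∃ v : V, 5 ≤ (G.neighborSet v).ncard) :
    iotaP3 G ≤ Fintype.card V / 4 := by
  classical
  obtain ⟨v, hv⟩ := hdeg
  have hS := P3Iso.conn_univ G hc
  have hB : P3Iso.Below G Finset.univ := fun T _ hT => P3Iso.claim_all G h6 T hT
  have hn : (P3Iso.nb G Finset.univ v).card = (G.neighborSet v).ncard := by
    rw [← Set.ncard_coe_finset]
    congr 1
    ext z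
    simp [P3Iso.nb]
  have hm := (P3Iso.main_deg G hS hB (Finset.mem_univ v) (by omega)).2 (by omega)
  obtain ⟨D, hD, hDc⟩ := P3Iso.f_spec G Finset.univ
  have h1 : iotaP3 G ≤ D.card := by
    apply Nat.sInf_le
    refine ⟨(D : Set V), ?_, Set.ncard_coe_finset D⟩
    rintro ⟨g, hg⟩
    have a1 := hg 0 1 (by simp [SimpleGraph.pathGraph_adj])
    have a2 := hg 1 2 (by simp [SimpleGraph.pathGraph_adj])
    have hne : ((g 0 : _) : V) ≠ (g 2 : _) := by
      intro h
      have := g.injective (Subtype.ext h)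
      exact absurd this (by decide)
    obtain ⟨d, hd, h⟩ := hD (g 0) (g 1) (g 2) (by simp) (by simp) (by simp) hne a1 a2
    have hz : ∀ i, ¬ P3Iso.Dom G d (g i) := by
      intro i h
      apply (g i).2
      rcases h with h | h
      · exact Or.inl (by rw [h]; exact hd)
      · exact Or.inr ⟨d, hd, h⟩
    rcases h with h | h | h <;> exact hz _ h
  rw [Finset.card_univ] at hm
  omega
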